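/- Second variation of the mean curvature under normal perturbations of an orthogonal parametrization. Let Ω ⊂ ℝ² be a domain and X : Ω → ℝ³ a smooth regular parametrization with X_t · X_θ = 0 and X_t ∧ X_θ ≠ 0 on Ω, with unit normal N. Then for every φ ∈ C²(Ω) and (t,θ) ∈ Ω, the second derivative at s = 0 of s ↦ 𝔐(X + sφN)(t,θ) exists and equals: φ_t²·( (X_tt·N)/(2|X_t|⁴) − (X_θθ·N)/(2|X_t|²|X_θ|²) ) + φ_θ²·( −(X_tt·N)/(2|X_t|²|X_θ|²) + (X_θθ·N)/(2|X_θ|⁴) ) + φ²·( −6(N_t·N_θ)(X_tθ·N)/(|X_t|²|X_θ|²) + 12(X_tt·N)(X_tθ·N)²/(|X_t|⁴|X_θ|²) + 12(X_θθ·N)(X_tθ·N)²/(|X_t|²|X_θ|⁴) − 3(X_tt·N)|N_t|²/|X_t|⁴ − 3(X_θθ·N)|N_θ|²/|X_θ|⁴ + 4(X_tt·N)³/|X_t|⁶ + 4(X_θθ·N)³/|X_θ|⁶ ) + φ_tφ_θ·( 2(X_tθ·N)/(|X_t|²|X_θ|²) ) + φφ_t·( −(N_θθ·X_t)/(|X_t|²|X_θ|²)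 − (N_tt·X_t)/|X_t|⁴ − (3/2)(X_tt·N)(∂_t|X_t|²)/|X_t|⁶ + (X_θθ·N)(∂_t|X_θ|²)/(|X_t|²|X_θ|⁴) + (1/2)(X_tt·N)(∂_t|X_θ|²)/(|X_t|⁴|X_θ|²) − (1/2)(X_tθ·N)(∂_θ|X_θ|²)/(|X_t|²|X_θ|⁴) − (3/2)(X_tθ·N)(∂_θ|X_t|²)/(|X_t|⁴|X_θ|²) ) + φφ_θ·( −(N_tt·X_θ)/(|X_t|²|X_θ|²) − (N_θθ·X_θ)/|X_θ|⁴ − (3/2)(X_θθ·N)(∂_θ|X_θ|²)/|X_θ|⁶ + (X_tt·N)(∂_θ|X_t|²)/(|X_t|⁴|X_θ|²) + (1/2)(X_θθ·N)(∂_θ|X_t|²)/(|X_t|²|X_θ|⁴) − (1/2)(X_tθ·N)(∂_t|X_t|²)/(|X_t|⁴|X_θ|²) − (3/2)(X_tθ·N)(∂_t|X_θ|²)/(|X_t|²|X_θ|⁴) ) + φφ_θθ·( 2(X_θθ·N)/|X_θ|⁴ ) + φφ_tt·( 2(X_tt·N)/|X_t|⁴ ) + φφ_tθ·( 4(X_tθ·N)/(|X_t|²|X_θ|²)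 ). -/

import Mathlib

noncomputable section

namespace Delaunay

/-- Vectors in ℝ³. -/
abbrev V3 : Type := Fin 3 → ℝ

/-- Euclidean scalar product on ℝ³. -/
def dot3 (v w : V3) : ℝ := v 0 * w 0 + v 1 * w 1 + v 2 * w 2

/-- Euclidean norm on ℝ³. -/
def norm3 (v : V3) : ℝ := Real.sqrt (dot3 v v)

/-- Cross product on ℝ³. -/
def cross3 (v w : V3) : V3 :=
  ![v 1 * w 2 - v 2 * w 1, v 2 * w 0 - v 0 * w 2, v 0 * w 1 - v 1 * w 0]

/-- Partial derivative with respect to the first variable. -/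
def pt {E : Type*} [NormedAddCommGroup E] [NormedSpace ℝ E] (X : ℝ → ℝ → E) (t θ : ℝ) : E :=
  deriv (fun s => X s θ) t

/-- Partial derivative with respect to the second variable. -/
def pθ {E : Type*} [NormedAddCommGroup E] [NormedSpace ℝ E] (X : ℝ → ℝ → E) (t θ : ℝ) : E :=
  deriv (fun s => X t s) θ

/-- Unit normal vector of a parametrized surface. -/
def normalVec (X : ℝ → ℝ → V3) (t θ : ℝ) : V3 :=
  (norm3 (cross3 (pt X t θ) (pθ X t θ)))⁻¹ • cross3 (pt X t θ) (pθ X t θ)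

/-- Mean curvature of a parametrized surface, 𝔐 = (𝓔𝓝 − 2𝓕𝓜 + 𝓖𝓛)/(2(𝓔𝓖 − 𝓕²)). -/
def meanCurv (X : ℝ → ℝ → V3) (t θ : ℝ) : ℝ :=
  (dot3 (pt X t θ) (pt X t θ) * dot3 (pθ (pθ X) t θ) (normalVec X t θ)
    - 2 * dot3 (pt X t θ) (pθ X t θ) * dot3 (pθ (pt X) t θ) (normalVec X t θ)
    + dot3 (pθ X t θ) (pθ X t θ) * dot3 (pt (pt X) t θ) (normalVec X t θ))
  / (2 * (dot3 (pt X t θ) (pt X t θ) * dot3 (pθ X t θ) (pθ X t θ)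
      - dot3 (pt X t θ) (pθ X t θ) ^ 2))

/-- Delaunay cylinder parametrization X_a. -/
def cyl (x z : ℝ → ℝ) : ℝ → ℝ → V3 := fun t θ =>
  ![x t * Real.cos θ, x t * Real.sin θ, z t]

/-- Delaunay torus parametrization X_{ε,a}. -/
def torus (x z : ℝ → ℝ) (ε : ℝ) : ℝ → ℝ → V3 := fun t θ =>
  ![x t * Real.cos θ,
    (ε⁻¹ + x t * Real.sin θ) * Real.cos (ε * z t),
    (ε⁻¹ + x t * Real.sin θ) * Real.sin (ε * z t)]

/-- Normal graph X + φN over a parametrized surface. -/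
def graphMap (X : ℝ → ℝ → V3) (φ : ℝ → ℝ → ℝ) : ℝ → ℝ → V3 := fun t θ =>
  X t θ + φ t θ • normalVec X t θ

/-- Normal perturbation family s ↦ X + sφN. -/
def pert (X : ℝ → ℝ → V3) (φ : ℝ → ℝ → ℝ) (s : ℝ) : ℝ → ℝ → V3 := fun t θ =>
  X t θ + (s * φ t θ) • normalVec X t θ

/-- Pointwise C² quantity |φ| + |∇φ| + |D²φ|. -/
def C2w (φ : ℝ → ℝ → ℝ) (t θ : ℝ) : ℝ :=
  |φ t θ| + ‖fderiv ℝ (fun p : ℝ × ℝ => φ p.1 p.2) (t, θ)‖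
    + ‖fderiv ℝ (fderiv ℝ (fun p : ℝ × ℝ => φ p.1 p.2)) (t, θ)‖

/-- The normalized Jacobi operator 𝓛 φ = 2x²·(d/ds)[𝔐(X + sφN)]|_{s=0}. -/
def jacobiAt (x : ℝ → ℝ) (X : ℝ → ℝ → V3) (φ : ℝ → ℝ → ℝ) (t θ : ℝ) : ℝ :=
  deriv (fun s : ℝ => 2 * x t ^ 2 * meanCurv (pert X φ s) t θ) 0

/-- The normalized Jacobi operator of the Delaunay cylinder: 𝓛_a φ = Δφ + 2(x² + γ²/x²)φ. -/
def Lop (x : ℝ → ℝ) (γ : ℝ) (φ : ℝ → ℝ → ℝ) (t θ : ℝ) : ℝ :=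
  pt (pt φ) t θ + pθ (pθ φ) t θ + 2 * (x t ^ 2 + γ ^ 2 / x t ^ 2) * φ t θ

/-- The first-order operator 𝓛_a^{(1)} in the expansion of the Jacobi operator of Delaunay
tori (here z_a' = x_a² − γ_a). -/
def L1op (x x' : ℝ → ℝ) (γ : ℝ) (φ : ℝ → ℝ → ℝ) (t θ : ℝ) : ℝ :=
  (-2 * (x t ^ 2 - γ) ^ 2 / x t * Real.sin θ) * pt (pt φ) t θ
  + (((x t ^ 2 - γ) ^ 2 * x' t / x t ^ 2 - 4 * (x t ^ 2 - γ) * x' t) * Real.sin θ) * pt φ t θ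
  + ((x t ^ 2 - γ) ^ 2 / x t * Real.cos θ) * pθ φ t θ
  + 2 * (((x t + γ / x t) * (2 * x t ^ 2 + (x t ^ 2 - γ) - (x t ^ 2 - γ) ^ 3 / x t)
      - 4 * ((x t ^ 2 - γ) ^ 2 / x t) * (x t + γ / x t) ^ 2
      + (x' t ^ 2 / x t) * (x t - γ / x t) ^ 2) * Real.sin θ) * φ t θ

/-- The first variation of the mean curvature along a normal perturbation of an orthogonal
parametrization. -/
def firstVariation (X : ℝ → ℝ → V3) (φ : ℝ → ℝ → ℝ) (t θ : ℝ) : ℝ :=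
  let E := dot3 (pt X t θ) (pt X t θ)
  let G := dot3 (pθ X t θ) (pθ X t θ)
  let N := normalVec X t θ
  let L := dot3 (pt (pt X) t θ) N
  let M := dot3 (pθ (pt X) t θ) N
  let Q := dot3 (pθ (pθ X) t θ) N
  let Nt2 := dot3 (pt (normalVec X) t θ) (pt (normalVec X) t θ)
  let Nθ2 := dot3 (pθ (normalVec X) t θ) (pθ (normalVec X) t θ)
  let dtE := pt (fun u v => dot3 (pt X u v) (pt X u v)) t θ
  let dθE := pθ (fun u v => dot3 (pt X u v) (pt X u v)) t θ
  let dtG := pt (fun u v => dot3 (pθ X u v) (pθ X u v)) t θ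
  let dθG := pθ (fun u v => dot3 (pθ X u v) (pθ X u v)) t θ
  (1 / (2 * E)) * pt (pt φ) t θ + (1 / (2 * G)) * pθ (pθ φ) t θ
  + (dtG / (4 * E * G) - dtE / (4 * E ^ 2)) * pt φ t θ
  + (dθE / (4 * E * G) - dθG / (4 * G ^ 2)) * pθ φ t θ
  + (2 * M ^ 2 / (E * G) - Nθ2 / (2 * G) - Nt2 / (2 * E) + L ^ 2 / E ^ 2 + Q ^ 2 / G ^ 2)
      * φ t θ

/-- The second variation of the mean curvature along a normal perturbation of an orthogonal
parametrization. -/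
def secondVariation (X : ℝ → ℝ → V3) (φ : ℝ → ℝ → ℝ) (t θ : ℝ) : ℝ :=
  let E := dot3 (pt X t θ) (pt X t θ)
  let G := dot3 (pθ X t θ) (pθ X t θ)
  let N := normalVec X t θ
  let L := dot3 (pt (pt X) t θ) N
  let M := dot3 (pθ (pt X) t θ) N
  let Q := dot3 (pθ (pθ X) t θ) N
  let P := dot3 (pt (normalVec X) t θ) (pθ (normalVec X) t θ)
  let Nt2 := dot3 (pt (normalVec X) t θ) (pt (normalVec X) t θ)
  let Nθ2 := dot3 (pθ (normalVec X) t θ) (pθ (normalVec X) t θ)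
  let dtE := pt (fun u v => dot3 (pt X u v) (pt X u v)) t θ
  let dθE := pθ (fun u v => dot3 (pt X u v) (pt X u v)) t θ
  let dtG := pt (fun u v => dot3 (pθ X u v) (pθ X u v)) t θ
  let dθG := pθ (fun u v => dot3 (pθ X u v) (pθ X u v)) t θ
  let Ntt := pt (pt (normalVec X)) t θ
  let Nθθ := pθ (pθ (normalVec X)) t θ
  pt φ t θ ^ 2 * (L / (2 * E ^ 2) - Q / (2 * E * G))
  + pθ φ t θ ^ 2 * (-(L / (2 * E * G)) + Q / (2 * G ^ 2))
  + φ t θ ^ 2 * (-(6 * P * M / (E * G)) + 12 * L * M ^ 2 / (E ^ 2 * G)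
      + 12 * Q * M ^ 2 / (E * G ^ 2) - 3 * L * Nt2 / E ^ 2 - 3 * Q * Nθ2 / G ^ 2
      + 4 * L ^ 3 / E ^ 3 + 4 * Q ^ 3 / G ^ 3)
  + pt φ t θ * pθ φ t θ * (2 * M / (E * G))
  + φ t θ * pt φ t θ * (-(dot3 Nθθ (pt X t θ) / (E * G)) - dot3 Ntt (pt X t θ) / E ^ 2
      - (3 / 2) * L * dtE / E ^ 3 + Q * dtG / (E * G ^ 2) + (1 / 2) * L * dtG / (E ^ 2 * G)
      - (1 / 2) * M * dθG / (E * G ^ 2) - (3 / 2) * M * dθE / (E ^ 2 * G))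
  + φ t θ * pθ φ t θ * (-(dot3 Ntt (pθ X t θ) / (E * G)) - dot3 Nθθ (pθ X t θ) / G ^ 2
      - (3 / 2) * Q * dθG / G ^ 3 + L * dθE / (E ^ 2 * G) + (1 / 2) * Q * dθE / (E * G ^ 2)
      - (1 / 2) * M * dtE / (E ^ 2 * G) - (3 / 2) * M * dtG / (E * G ^ 2))
  + φ t θ * pθ (pθ φ) t θ * (2 * Q / G ^ 2)
  + φ t θ * pt (pt φ) t θ * (2 * L / E ^ 2)
  + φ t θ * pθ (pt φ) t θ * (4 * M / (E * G))

/-! ### Second order jets at zero -/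

/-- `f` is twice differentiable at `0` with value `c0` and derivatives `c1`, `c2`. -/
def Jet (f : ℝ → ℝ) (c0 c1 c2 : ℝ) : Prop :=
  ∃ f' : ℝ → ℝ, (∀ᶠ s in nhds (0 : ℝ), HasDerivAt f (f' s) s) ∧ f 0 = c0 ∧ f' 0 = c1 ∧
    HasDerivAt f' c2 0

lemma Jet.hasDerivAt {f : ℝ → ℝ} {c0 c1 c2 : ℝ} (h : Jet f c0 c1 c2) :
    HasDerivAt (fun s => deriv f s) c2 0 := by
  obtain ⟨f', h1, _, _, h4⟩ := h
  refine h4.congr_of_eventuallyEq ?_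
  filter_upwards [h1] with s hs using hs.deriv

lemma Jet.cast {f : ℝ → ℝ} {c0 c1 c2 d0 d1 d2 : ℝ} (h : Jet f c0 c1 c2)
    (h0 : c0 = d0) (h1 : c1 = d1) (h2 : c2 = d2) : Jet f d0 d1 d2 := by
  subst h0 h1 h2; exact h

lemma Jet.affine (a b : ℝ) : Jet (fun s => a + s * b) a b 0 := by
  refine ⟨fun _ => b, Filter.Eventually.of_forall fun s => ?_, by simp, rfl, hasDerivAt_const _ _⟩
  simpa using ((hasDerivAt_id s).mul_const b).const_add a

lemma Jet.add {f g : ℝ → ℝ} {c0 c1 c2 d0 d1 d2 : ℝ} (hf : Jet f c0 c1 c2) (hg : Jet g d0 d1 d2) :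
    Jet (fun s => f s + g s) (c0 + d0) (c1 + d1) (c2 + d2) := by
  obtain ⟨f', h1, h2, h3, h4⟩ := hf
  obtain ⟨g', k1, k2, k3, k4⟩ := hg
  refine ⟨fun s => f' s + g' s, ?_, by simp only [h2, k2], by simp only [h3, k3], h4.add k4⟩
  filter_upwards [h1, k1] with s hs ks using hs.add ks

lemma Jet.mul {f g : ℝ → ℝ} {c0 c1 c2 d0 d1 d2 : ℝ} (hf : Jet f c0 c1 c2) (hg : Jet g d0 d1 d2) :
    Jet (fun s => f s * g s) (c0 * d0) (c1 * d0 + c0 * d1) (c2 * d0 + 2 * c1 * d1 + c0 * d2) := by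
  obtain ⟨f', h1, h2, h3, h4⟩ := hf
  obtain ⟨g', k1, k2, k3, k4⟩ := hg
  refine ⟨fun s => f' s * g s + f s * g' s, ?_, by simp only [h2, k2], by simp only [h2, h3, k2, k3], ?_⟩
  · filter_upwards [h1, k1] with s hs ks using hs.mul ks
  · have := (h4.mul k1.self_of_nhds).add (h1.self_of_nhds.mul k4)
    refine this.congr_deriv ?_
    rw [h2, h3, k2, k3]; ring

lemma Jet.const_mul {f : ℝ → ℝ} {c0 c1 c2 : ℝ} (k : ℝ) (hf : Jet f c0 c1 c2) :
    Jet (fun s => k * f s) (k * c0) (k * c1) (k * c2) := by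
  obtain ⟨f', h1, h2, h3, h4⟩ := hf
  refine ⟨fun s => k * f' s, ?_, by simp only [h2], by simp only [h3], h4.const_mul k⟩
  filter_upwards [h1] with s hs using hs.const_mul k

lemma Jet.sub {f g : ℝ → ℝ} {c0 c1 c2 d0 d1 d2 : ℝ} (hf : Jet f c0 c1 c2) (hg : Jet g d0 d1 d2) :
    Jet (fun s => f s - g s) (c0 - d0) (c1 - d1) (c2 - d2) := by
  obtain ⟨f', h1, h2, h3, h4⟩ := hf
  obtain ⟨g', k1, k2, k3, k4⟩ := hg
  refine ⟨fun s => f' s - g' s, ?_, by simp only [h2, k2], by simp only [h3, k3], h4.sub k4⟩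
  filter_upwards [h1, k1] with s hs ks using hs.sub ks

lemma Jet.inv {f : ℝ → ℝ} {c1 c2 : ℝ} (hf : Jet f 1 c1 c2) :
    Jet (fun s => (f s)⁻¹) 1 (-c1) (2 * c1 ^ 2 - c2) := by
  obtain ⟨f', h1, h2, h3, h4⟩ := hf
  have hne : ∀ᶠ s in nhds (0 : ℝ), f s ≠ 0 :=
    h1.self_of_nhds.continuousAt.eventually_ne (by rw [h2]; exact one_ne_zero)
  refine ⟨fun s => -f' s / f s ^ 2, ?_, by simp only [h2]; norm_num, by simp only [h2, h3]; norm_num, ?_⟩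
  · filter_upwards [h1, hne] with s hs hs' using hs.inv hs'
  · have h5 := h1.self_of_nhds
    have := h4.neg.div (h5.pow 2) (by simp [h2])
    refine this.congr_deriv ?_
    simp [h2, h3]; ring

lemma Jet.sqrt {f : ℝ → ℝ} {c1 c2 : ℝ} (hf : Jet f 1 c1 c2) :
    Jet (fun s => Real.sqrt (f s)) 1 (c1 / 2) (c2 / 2 - c1 ^ 2 / 4) := by
  obtain ⟨f', h1, h2, h3, h4⟩ := hf
  have hne : ∀ᶠ s in nhds (0 : ℝ), f s ≠ 0 :=
    h1.self_of_nhds.continuousAt.eventually_ne (by rw [h2]; exact one_ne_zero)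
  refine ⟨fun s => f' s / (2 * Real.sqrt (f s)), ?_, by simp only [h2]; norm_num,
    by simp only [h2, h3]; norm_num, ?_⟩
  · filter_upwards [h1, hne] with s hs hs' using hs.sqrt hs'
  · have h5 := (h1.self_of_nhds.sqrt (by rw [h2]; norm_num)).const_mul 2
    have := h4.div h5 (by simp [h2])
    refine this.congr_deriv ?_
    simp [h2, h3]; ring

/-! ### Frames -/

lemma dot3_comm (v w : V3) : dot3 v w = dot3 w v := by simp only [dot3]; ring
lemma dot3_add (u v w : V3) : dot3 (u + v) w = dot3 u w + dot3 v w := by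
  simp only [dot3, Pi.add_apply]; ring
lemma dot3_smul (k : ℝ) (v w : V3) : dot3 (k • v) w = k * dot3 v w := by
  simp only [dot3, Pi.smul_apply, smul_eq_mul]; ring
lemma dot3_smul_right (k : ℝ) (v w : V3) : dot3 v (k • w) = k * dot3 v w := by
  simp only [dot3, Pi.smul_apply, smul_eq_mul]; ring

/-- Positively oriented orthonormal frames. -/
structure Frame (u v w : V3) : Prop where
  uu : dot3 u u = 1
  vv : dot3 v v = 1
  uv : dot3 u v = 0
  hw : w = cross3 u v

lemma Frame.uw {u v w : V3} (h : Frame u v w) : dot3 u w = 0 := by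
  rw [h.hw]; simp [dot3, cross3]; ring
lemma Frame.vw {u v w : V3} (h : Frame u v w) : dot3 v w = 0 := by
  rw [h.hw]; simp [dot3, cross3]; ring
lemma Frame.ww {u v w : V3} (h : Frame u v w) : dot3 w w = 1 := by
  have : dot3 w w = dot3 u u * dot3 v v - dot3 u v ^ 2 := by
    rw [h.hw]; simp [dot3, cross3]; ring
  rw [this, h.uu, h.vv, h.uv]; ring

lemma Frame.dot {u v w : V3} (h : Frame u v w) (x y : V3) :
    dot3 x y = dot3 x u * dot3 y u + dot3 x v * dot3 y v + dot3 x w * dot3 y w := by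
  let U : Matrix (Fin 3) (Fin 3) ℝ := Matrix.of ![u, v, w]
  have h1 : U * U.transpose = 1 := by
    have a1 := h.uu; have a2 := h.vv; have a3 := h.uv; have a4 := h.uw; have a5 := h.vw
    have a6 := h.ww
    simp only [dot3] at a1 a2 a3 a4 a5 a6
    ext i j
    fin_cases i <;> fin_cases j <;> simp [U, Matrix.mul_apply, Fin.sum_univ_three] <;> linarith
  have h2 : U.transpose * U = 1 := mul_eq_one_comm.mp h1
  have e := fun i j => congrFun (congrFun h2 i) j
  have e00 := e 0 0; have e01 := e 0 1; have e02 := e 0 2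
  have e11 := e 1 1; have e12 := e 1 2; have e22 := e 2 2
  simp [U, Matrix.mul_apply, Fin.sum_univ_three] at e00 e01 e02 e11 e12 e22
  simp only [dot3]
  linear_combination -(x 0 * y 0) * e00 - (x 0 * y 1 + x 1 * y 0) * e01
    - (x 0 * y 2 + x 2 * y 0) * e02 - x 1 * y 1 * e11 - (x 1 * y 2 + x 2 * y 1) * e12
    - x 2 * y 2 * e22

lemma Frame.triple {u v w : V3} (h : Frame u v w) (x y z : V3) :
    dot3 x (cross3 y z) =
      dot3 x u * (dot3 y v * dot3 z w - dot3 y w * dot3 z v)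
      + dot3 x v * (dot3 y w * dot3 z u - dot3 y u * dot3 z w)
      + dot3 x w * (dot3 y u * dot3 z v - dot3 y v * dot3 z u) := by
  have h1 : dot3 w (cross3 u v) = 1 := by rw [← h.hw]; exact h.ww
  have : dot3 x (cross3 y z) = dot3 x (cross3 y z) * dot3 w (cross3 u v) := by rw [h1, mul_one]
  rw [this]
  simp [dot3, cross3]; ring

lemma lagrange (x y : V3) :
    dot3 (cross3 x y) (cross3 x y) = dot3 x x * dot3 y y - dot3 x y ^ 2 := by
  simp [dot3, cross3]; ring

/-! ### The jet of the mean curvature in scaled frame coordinates -/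

lemma jet_dot (a1 b1 a2 b2 a3 b3 c1 d1 c2 d2 c3 d3 : ℝ) :
    Jet (fun s => (a1 + s * b1) * (c1 + s * d1) + (a2 + s * b2) * (c2 + s * d2)
        + (a3 + s * b3) * (c3 + s * d3))
      (a1 * c1 + a2 * c2 + a3 * c3)
      (b1 * c1 + a1 * d1 + b2 * c2 + a2 * d2 + b3 * c3 + a3 * d3)
      (2 * (b1 * d1 + b2 * d2 + b3 * d3)) := by
  have h := (((Jet.affine a1 b1).mul (Jet.affine c1 d1)).add
    ((Jet.affine a2 b2).mul (Jet.affine c2 d2))).add ((Jet.affine a3 b3).mul (Jet.affine c3 d3))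
  exact h.cast rfl (by ring) (by ring)

lemma jet_det (x1 x1' x2 x2' x3 x3' y1 y1' y2 y2' y3 y3' z1 z1' z2 z2' z3 z3' : ℝ) :
    Jet (fun s => (x1 + s * x1') * ((y2 + s * y2') * (z3 + s * z3') - (y3 + s * y3') * (z2 + s * z2'))
        + (x2 + s * x2') * ((y3 + s * y3') * (z1 + s * z1') - (y1 + s * y1') * (z3 + s * z3'))
        + (x3 + s * x3') * ((y1 + s * y1') * (z2 + s * z2') - (y2 + s * y2') * (z1 + s * z1')))
      (x1 * (y2 * z3 - y3 * z2) + x2 * (y3 * z1 - y1 * z3) + x3 * (y1 * z2 - y2 * z1))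
      (x1' * (y2 * z3 - y3 * z2) + x2' * (y3 * z1 - y1 * z3) + x3' * (y1 * z2 - y2 * z1)
       + x1 * (y2' * z3 - y3' * z2) + x2 * (y3' * z1 - y1' * z3) + x3 * (y1' * z2 - y2' * z1)
       + x1 * (y2 * z3' - y3 * z2') + x2 * (y3 * z1' - y1 * z3') + x3 * (y1 * z2' - y2 * z1'))
      (2 * (x1 * (y2' * z3' - y3' * z2') + x2 * (y3' * z1' - y1' * z3')
          + x3 * (y1' * z2' - y2' * z1')
       + x1' * (y2 * z3' - y3 * z2') + x2' * (y3 * z1' - y1 * z3') + x3' * (y1 * z2' - y2 * z1')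
       + x1' * (y2' * z3 - y3' * z2) + x2' * (y3' * z1 - y1' * z3)
       + x3' * (y1' * z2 - y2' * z1))) := by
  have m := fun a b c d => (Jet.affine a b).mul (Jet.affine c d)
  have h := (((Jet.affine x1 x1').mul ((m y2 y2' z3 z3').sub (m y3 y3' z2 z2'))).add
    ((Jet.affine x2 x2').mul ((m y3 y3' z1 z1').sub (m y1 y1' z3 z3')))).add
    ((Jet.affine x3 x3').mul ((m y1 y1' z2 z2').sub (m y2 y2' z1 z1')))
  exact h.cast rfl (by ring) (by ring)

/-- Determinant. -/
def det9 (x1 x2 x3 y1 y2 y3 z1 z2 z3 : ℝ) : ℝ :=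
  x1 * (y2 * z3 - y3 * z2) + x2 * (y3 * z1 - y1 * z3) + x3 * (y1 * z2 - y2 * z1)

/-- Scalar product. -/
def dot6 (x1 x2 x3 y1 y2 y3 : ℝ) : ℝ := x1 * y1 + x2 * y2 + x3 * y3

/-- Mean curvature in coordinates. -/
def mcc (a1 a2 a3 b1 b2 b3 A1 A2 A3 B1 B2 B3 C1 C2 C3 : ℝ) : ℝ :=
  (dot6 a1 a2 a3 a1 a2 a3 * det9 C1 C2 C3 a1 a2 a3 b1 b2 b3
    - 2 * (dot6 a1 a2 a3 b1 b2 b3 * det9 B1 B2 B3 a1 a2 a3 b1 b2 b3)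
    + dot6 b1 b2 b3 b1 b2 b3 * det9 A1 A2 A3 a1 a2 a3 b1 b2 b3)
  * ((dot6 a1 a2 a3 a1 a2 a3 * dot6 b1 b2 b3 b1 b2 b3
      - dot6 a1 a2 a3 b1 b2 b3 * dot6 a1 a2 a3 b1 b2 b3)⁻¹
    * (Real.sqrt (dot6 a1 a2 a3 a1 a2 a3 * dot6 b1 b2 b3 b1 b2 b3
      - dot6 a1 a2 a3 b1 b2 b3 * dot6 a1 a2 a3 b1 b2 b3))⁻¹)

lemma jet_final {p w : ℝ → ℝ} {p0 p1 p2 w1 w2 : ℝ} (hp : Jet p p0 p1 p2) (hw : Jet w 1 w1 w2) :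
    Jet (fun s => p s * ((w s)⁻¹ * (Real.sqrt (w s))⁻¹)) p0 (p1 - 3 / 2 * p0 * w1)
      (p2 - 3 * p1 * w1 - 3 / 2 * p0 * w2 + 15 / 4 * p0 * w1 ^ 2) :=
  (hp.mul (hw.inv.mul hw.sqrt.inv)).cast (by ring) (by ring) (by ring)

set_option maxHeartbeats 4000000 in
lemma jet_core (l m q x1 y1 y2 z2 n1 n2 k1 k2 j1 j2 f f1 f2 f11 f12 f22 : ℝ)
    (hj1 : j1 = n2 - l * y1 - m * y2 + m * x1 - q * y1)
    (hj2 : j2 = k1 - m * y1 - q * y2 - l * y2 + m * z2) :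
    ∃ c0 c1, Jet (fun s => mcc
      (1 + s * (-(f * l))) (0 + s * (-(f * m))) (0 + s * f1)
      (0 + s * (-(f * m))) (1 + s * (-(f * q))) (0 + s * f2)
      (x1 + s * (-(2 * f1 * l) + f * n1)) (-y1 + s * (-(2 * f1 * m) + f * n2))
        (l + s * (f11 - f * (l ^ 2 + m ^ 2)))
      (y1 + s * (-(f1 * m) - f2 * l + f * j1)) (y2 + s * (-(f1 * q) - f2 * m + f * j2))
        (m + s * (f12 - f * (l * m + m * q)))
      (-y2 + s * (-(2 * f2 * m) + f * k1)) (z2 + s * (-(2 * f2 * q) + f * k2))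
        (q + s * (f22 - f * (m ^ 2 + q ^ 2)))) c0 c1
      (2 * (f1 ^ 2 * (l / 2 - q / 2) + f2 ^ 2 * (-(l / 2) + q / 2)
        + f ^ 2 * (-(6 * (l * m + m * q) * m) + 12 * l * m ^ 2 + 12 * q * m ^ 2
            - 3 * l * (l ^ 2 + m ^ 2) - 3 * q * (m ^ 2 + q ^ 2) + 4 * l ^ 3 + 4 * q ^ 3)
        + f1 * f2 * (2 * m)
        + f * f1 * (-k1 - n1 - 3 * l * x1 + 2 * q * y2 + l * y2 - m * z2 - 3 * m * y1)
        + f * f2 * (-n2 - k2 - 3 * q * z2 + 2 * l * y1 + q * y1 - m * x1 - 3 * m * y2)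
        + f * f22 * (2 * q) + f * f11 * (2 * l) + f * f12 * (4 * m))) := by
  have hE := (jet_dot 1 (-(f * l)) 0 (-(f * m)) 0 f1 1 (-(f * l)) 0 (-(f * m)) 0 f1).cast
    (d0 := 1) (d1 := -(2 * f * l)) (d2 := 2 * (f ^ 2 * l ^ 2 + f ^ 2 * m ^ 2 + f1 ^ 2))
    (by ring) (by ring) (by ring)
  have hG := (jet_dot 0 (-(f * m)) 1 (-(f * q)) 0 f2 0 (-(f * m)) 1 (-(f * q)) 0 f2).cast
    (d0 := 1) (d1 := -(2 * f * q)) (d2 := 2 * (f ^ 2 * q ^ 2 + f ^ 2 * m ^ 2 + f2 ^ 2))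
    (by ring) (by ring) (by ring)
  have hF := (jet_dot 1 (-(f * l)) 0 (-(f * m)) 0 f1 0 (-(f * m)) 1 (-(f * q)) 0 f2).cast
    (d0 := 0) (d1 := -(2 * f * m)) (d2 := 2 * (f ^ 2 * (l * m + m * q) + f1 * f2))
    (by ring) (by ring) (by ring)
  have hD := fun a a' b b' c c' => (jet_det a a' b b' c c'
      1 (-(f * l)) 0 (-(f * m)) 0 f1 0 (-(f * m)) 1 (-(f * q)) 0 f2).cast
    (d0 := c) (d1 := c' - a * f1 - b * f2 - c * f * (l + q))
    (d2 := 2 * (-(a' * f1) - b' * f2 - c' * f * (l + q) + a * f * (q * f1 - m * f2)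
      + b * f * (l * f2 - m * f1) + c * f ^ 2 * (l * q - m ^ 2)))
    (by ring) (by ring) (by ring)
  have hW := ((hE.mul hG).sub (hF.mul hF)).cast
    (d0 := 1) (d1 := -(2 * f * (l + q)))
    (d2 := 2 * (f ^ 2 * (l ^ 2 + q ^ 2 + 4 * l * q - 2 * m ^ 2) + f1 ^ 2 + f2 ^ 2))
    (by ring) (by ring) (by ring)
  have hP := ((hE.mul (hD (-y2) (-(2 * f2 * m) + f * k1) z2 (-(2 * f2 * q) + f * k2) q
      (f22 - f * (m ^ 2 + q ^ 2)))).sub ((hF.mul (hD y1 (-(f1 * m) - f2 * l + f * j1) y2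
      (-(f1 * q) - f2 * m + f * j2) m (f12 - f * (l * m + m * q)))).const_mul 2)).add
      (hG.mul (hD x1 (-(2 * f1 * l) + f * n1) (-y1) (-(2 * f1 * m) + f * n2) l
        (f11 - f * (l ^ 2 + m ^ 2))))
  refine ⟨_, _, (jet_final hP hW).cast rfl rfl ?_⟩
  subst hj1 hj2
  ring

/-- Mean curvature in terms of the derivatives of the parametrization. -/
def mc (Yt Yh Ytt Yth Yhh : V3) : ℝ :=
  (dot3 Yt Yt * dot3 Yhh ((norm3 (cross3 Yt Yh))⁻¹ • cross3 Yt Yh)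
    - 2 * dot3 Yt Yh * dot3 Yth ((norm3 (cross3 Yt Yh))⁻¹ • cross3 Yt Yh)
    + dot3 Yh Yh * dot3 Ytt ((norm3 (cross3 Yt Yh))⁻¹ • cross3 Yt Yh))
  / (2 * (dot3 Yt Yt * dot3 Yh Yh - dot3 Yt Yh ^ 2))

lemma mc_scaled {u v w : V3} (h : Frame u v w) {e g : ℝ} (he : 0 < e) (hg : 0 < g)
    (a b A B C : V3) {a1 a2 a3 b1 b2 b3 A1 A2 A3 B1 B2 B3 C1 C2 C3 : ℝ}
    (ha1 : dot3 a u = e * a1) (ha2 : dot3 a v = e * a2) (ha3 : dot3 a w = e * a3)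
    (hb1 : dot3 b u = g * b1) (hb2 : dot3 b v = g * b2) (hb3 : dot3 b w = g * b3)
    (hA1 : dot3 A u = e ^ 2 * A1) (hA2 : dot3 A v = e ^ 2 * A2) (hA3 : dot3 A w = e ^ 2 * A3)
    (hB1 : dot3 B u = e * g * B1) (hB2 : dot3 B v = e * g * B2) (hB3 : dot3 B w = e * g * B3)
    (hC1 : dot3 C u = g ^ 2 * C1) (hC2 : dot3 C v = g ^ 2 * C2) (hC3 : dot3 C w = g ^ 2 * C3) :
    mc a b A B C = 1 / 2 * mcc a1 a2 a3 b1 b2 b3 A1 A2 A3 B1 B2 B3 C1 C2 C3 := by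
  have e1 : dot3 a a = e ^ 2 * dot6 a1 a2 a3 a1 a2 a3 := by
    rw [h.dot, ha1, ha2, ha3, dot6]; ring
  have e2 : dot3 b b = g ^ 2 * dot6 b1 b2 b3 b1 b2 b3 := by
    rw [h.dot, hb1, hb2, hb3, dot6]; ring
  have e3 : dot3 a b = e * g * dot6 a1 a2 a3 b1 b2 b3 := by
    rw [h.dot, ha1, ha2, ha3, hb1, hb2, hb3, dot6]; ring
  have e4 : dot3 A (cross3 a b) = e ^ 3 * g * det9 A1 A2 A3 a1 a2 a3 b1 b2 b3 := by
    rw [h.triple, ha1, ha2, ha3, hb1, hb2, hb3, hA1, hA2, hA3, det9]; ring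
  have e5 : dot3 B (cross3 a b) = e ^ 2 * g ^ 2 * det9 B1 B2 B3 a1 a2 a3 b1 b2 b3 := by
    rw [h.triple, ha1, ha2, ha3, hb1, hb2, hb3, hB1, hB2, hB3, det9]; ring
  have e6 : dot3 C (cross3 a b) = e * g ^ 3 * det9 C1 C2 C3 a1 a2 a3 b1 b2 b3 := by
    rw [h.triple, ha1, ha2, ha3, hb1, hb2, hb3, hC1, hC2, hC3, det9]; ring
  rw [mc, mcc]
  simp only [dot3_smul_right]
  rw [norm3, lagrange, e1, e2, e3, e4, e5, e6]
  generalize dot6 a1 a2 a3 a1 a2 a3 = p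
  generalize dot6 b1 b2 b3 b1 b2 b3 = q
  generalize dot6 a1 a2 a3 b1 b2 b3 = r
  generalize det9 A1 A2 A3 a1 a2 a3 b1 b2 b3 = x
  generalize det9 B1 B2 B3 a1 a2 a3 b1 b2 b3 = y
  generalize det9 C1 C2 C3 a1 a2 a3 b1 b2 b3 = z
  have hW : e ^ 2 * p * (g ^ 2 * q) - (e * g * r) ^ 2 = (e * g) ^ 2 * (p * q - r * r) := by ring
  rw [hW, Real.sqrt_mul (sq_nonneg _), Real.sqrt_sq (by positivity)]
  generalize p * q - r * r = W
  generalize hS : Real.sqrt W = S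
  rw [div_eq_mul_inv, mul_inv, mul_inv, mul_inv]
  have hee : e ^ 3 * g ^ 3 * ((e * g)⁻¹ * ((e * g) ^ 2)⁻¹) = 1 := by field_simp
  linear_combination ((p * z - 2 * (r * y) + q * x) * S⁻¹ * W⁻¹ * (1 / 2)) * hee

lemma dot3_self_pos {x : V3} (hx : x ≠ 0) : 0 < dot3 x x := by
  have k0 := mul_self_nonneg (x 0)
  have k1 := mul_self_nonneg (x 1)
  have k2 := mul_self_nonneg (x 2)
  have hnn : 0 ≤ dot3 x x := by simp only [dot3]; linarith
  refine lt_of_le_of_ne hnn fun h0 => hx ?_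
  simp only [dot3] at h0
  have e0 : x 0 = 0 := mul_self_eq_zero.mp (by linarith)
  have e1 : x 1 = 0 := mul_self_eq_zero.mp (by linarith)
  have e2 : x 2 = 0 := mul_self_eq_zero.mp (by linarith)
  ext i
  fin_cases i
  · exact e0
  · exact e1
  · exact e2

/-- The second variation formula in terms of pointwise data. -/
def svVec (a b N A B C Nt Nh Ntt Nhh : V3) (dtE dhE dtG dhG f ft fh ftt fth fhh : ℝ) : ℝ :=
  let E := dot3 a a
  let G := dot3 b b
  let L := dot3 A N
  let M := dot3 B N
  let Q := dot3 C N
  let P := dot3 Nt Nh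
  let Nt2 := dot3 Nt Nt
  let Nθ2 := dot3 Nh Nh
  ft ^ 2 * (L / (2 * E ^ 2) - Q / (2 * E * G))
  + fh ^ 2 * (-(L / (2 * E * G)) + Q / (2 * G ^ 2))
  + f ^ 2 * (-(6 * P * M / (E * G)) + 12 * L * M ^ 2 / (E ^ 2 * G)
      + 12 * Q * M ^ 2 / (E * G ^ 2) - 3 * L * Nt2 / E ^ 2 - 3 * Q * Nθ2 / G ^ 2
      + 4 * L ^ 3 / E ^ 3 + 4 * Q ^ 3 / G ^ 3)
  + ft * fh * (2 * M / (E * G))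
  + f * ft * (-(dot3 Nhh a / (E * G)) - dot3 Ntt a / E ^ 2
      - (3 / 2) * L * dtE / E ^ 3 + Q * dtG / (E * G ^ 2) + (1 / 2) * L * dtG / (E ^ 2 * G)
      - (1 / 2) * M * dhG / (E * G ^ 2) - (3 / 2) * M * dhE / (E ^ 2 * G))
  + f * fh * (-(dot3 Ntt b / (E * G)) - dot3 Nhh b / G ^ 2
      - (3 / 2) * Q * dhG / G ^ 3 + L * dhE / (E ^ 2 * G) + (1 / 2) * Q * dhE / (E * G ^ 2)
      - (1 / 2) * M * dtE / (E ^ 2 * G) - (3 / 2) * M * dtG / (E * G ^ 2))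
  + f * fhh * (2 * Q / G ^ 2)
  + f * ftt * (2 * L / E ^ 2)
  + f * fth * (4 * M / (E * G))

set_option maxHeartbeats 4000000 in
lemma core_vec (a b N A B C Nt Nh Ntt Nth Nhh : V3) (f ft fh ftt fth fhh : ℝ)
    (hab : dot3 a b = 0) (hne : cross3 a b ≠ 0)
    (hN : N = (norm3 (cross3 a b))⁻¹ • cross3 a b)
    (h1 : dot3 A N + dot3 a Nt = 0) (h2 : dot3 B N + dot3 a Nh = 0)
    (h3 : dot3 B N + dot3 b Nt = 0) (h4 : dot3 C N + dot3 b Nh = 0)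
    (h5 : dot3 Nt N = 0) (h6 : dot3 Nh N = 0)
    (h7 : dot3 Ntt N + dot3 Nt Nt = 0) (h8 : dot3 Nth N + dot3 Nt Nh = 0)
    (h9 : dot3 Nhh N + dot3 Nh Nh = 0)
    (h10 : dot3 A b + dot3 a B = 0) (h11 : dot3 B b + dot3 a C = 0)
    (h12 : dot3 A Nh + dot3 a Nth = dot3 B Nt + dot3 b Ntt)
    (h13 : dot3 B Nh + dot3 a Nhh = dot3 C Nt + dot3 b Nth) :
    HasDerivAt (fun s : ℝ => deriv (fun r : ℝ => mc (a + r • (ft • N + f • Nt)) (b + r • (fh • N + f • Nh))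
      (A + r • (ftt • N + (2 * ft) • Nt + f • Ntt))
      (B + r • (fth • N + ft • Nh + fh • Nt + f • Nth))
      (C + r • (fhh • N + (2 * fh) • Nh + f • Nhh))) s)
      (svVec a b N A B C Nt Nh Ntt Nhh (2 * dot3 A a) (2 * dot3 B a) (2 * dot3 B b) (2 * dot3 C b)
        f ft fh ftt fth fhh) 0 := by
  have hpos := dot3_self_pos hne
  have hEG : 0 < dot3 a a * dot3 b b := by
    rw [lagrange, hab] at hpos; linarith
  have hsq : ∀ x : V3, 0 ≤ dot3 x x := fun x => by
    simp only [dot3]; nlinarith [sq_nonneg (x 0), sq_nonneg (x 1), sq_nonneg (x 2)]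
  have hE : 0 < dot3 a a := lt_of_le_of_ne (hsq a) fun h => by rw [← h] at hEG; simp at hEG
  have hG : 0 < dot3 b b := lt_of_le_of_ne (hsq b) fun h => by rw [← h] at hEG; simp at hEG
  obtain ⟨e, he, hee⟩ : ∃ e, 0 < e ∧ dot3 a a = e ^ 2 :=
    ⟨_, Real.sqrt_pos.mpr hE, (Real.sq_sqrt hE.le).symm⟩
  obtain ⟨g, hg, hgg⟩ : ∃ g, 0 < g ∧ dot3 b b = g ^ 2 :=
    ⟨_, Real.sqrt_pos.mpr hG, (Real.sq_sqrt hG.le).symm⟩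
  have hnorm : norm3 (cross3 a b) = e * g := by
    rw [norm3, lagrange, hab, hee, hgg, show e ^ 2 * g ^ 2 - 0 ^ 2 = (e * g) ^ 2 by ring,
      Real.sqrt_sq (by positivity)]
  rw [hnorm] at hN
  obtain ⟨u, hu⟩ : ∃ u : V3, a = e • u := ⟨e⁻¹ • a, by rw [smul_smul, mul_inv_cancel₀ he.ne', one_smul]⟩
  obtain ⟨v, hv⟩ : ∃ v : V3, b = g • v := ⟨g⁻¹ • b, by rw [smul_smul, mul_inv_cancel₀ hg.ne', one_smul]⟩
  have he' := he.ne'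
  have hg' := hg.ne'
  have hfr : Frame u v N := by
    refine ⟨?_, ?_, ?_, ?_⟩
    · rw [hu, dot3_smul, dot3_smul_right] at hee
      have : e ^ 2 * (dot3 u u - 1) = 0 := by linear_combination hee
      have := (mul_eq_zero.mp this).resolve_left (by positivity)
      linarith
    · rw [hv, dot3_smul, dot3_smul_right] at hgg
      have : g ^ 2 * (dot3 v v - 1) = 0 := by linear_combination hgg
      have := (mul_eq_zero.mp this).resolve_left (by positivity)
      linarith
    · rw [hu, hv, dot3_smul, dot3_smul_right] at hab
      have := (mul_eq_zero.mp hab).resolve_left he'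
      exact (mul_eq_zero.mp this).resolve_left hg'
    · rw [hN, hu, hv]
      ext i
      fin_cases i <;> simp [cross3] <;> field_simp
  clear hN hnorm hne hpos hEG hE hG
  subst hu hv
  have sc : ∀ k : ℝ, k ≠ 0 → ∀ x : ℝ, ∃ y, x = k * y := fun k hk x => ⟨x / k, by field_simp⟩
  obtain ⟨l, hl⟩ := sc (e ^ 2) (by positivity) (dot3 A N)
  obtain ⟨m, hm⟩ := sc (e * g) (by positivity) (dot3 B N)
  obtain ⟨q, hq⟩ := sc (g ^ 2) (by positivity) (dot3 C N)
  obtain ⟨x1, hx1⟩ := sc (e ^ 2) (by positivity) (dot3 A u)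
  obtain ⟨x2, hx2⟩ := sc (e ^ 2) (by positivity) (dot3 A v)
  obtain ⟨y1, hy1⟩ := sc (e * g) (by positivity) (dot3 B u)
  obtain ⟨y2, hy2⟩ := sc (e * g) (by positivity) (dot3 B v)
  obtain ⟨z1, hz1⟩ := sc (g ^ 2) (by positivity) (dot3 C u)
  obtain ⟨z2, hz2⟩ := sc (g ^ 2) (by positivity) (dot3 C v)
  obtain ⟨n1, hn1⟩ := sc (e ^ 2) (by positivity) (dot3 Ntt u)
  obtain ⟨n2, hn2⟩ := sc (e ^ 2) (by positivity) (dot3 Ntt v)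
  obtain ⟨j1, hj1⟩ := sc (e * g) (by positivity) (dot3 Nth u)
  obtain ⟨j2, hj2⟩ := sc (e * g) (by positivity) (dot3 Nth v)
  obtain ⟨k1, hk1⟩ := sc (g ^ 2) (by positivity) (dot3 Nhh u)
  obtain ⟨k2, hk2⟩ := sc (g ^ 2) (by positivity) (dot3 Nhh v)
  obtain ⟨f1, rfl⟩ := sc e he' ft
  obtain ⟨f2, rfl⟩ := sc g hg' fh
  obtain ⟨f11, rfl⟩ := sc (e ^ 2) (by positivity) ftt
  obtain ⟨f12, rfl⟩ := sc (e * g) (by positivity) fth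
  obtain ⟨f22, rfl⟩ := sc (g ^ 2) (by positivity) fhh
  have cancel : ∀ k : ℝ, k ≠ 0 → ∀ x y : ℝ, k * x = k * y → x = y :=
    fun k hk x y h => mul_left_cancel₀ hk h
  simp only [dot3_smul] at h1 h2 h3 h4 h10 h11 h12 h13 hee hgg
  simp only [dot3_smul_right] at h10 h11
  have t1 : dot3 Nt u = e * -l := by
    rw [dot3_comm]; apply cancel e he'; linear_combination h1 - hl
  have t2 : dot3 Nt v = e * -m := by
    rw [dot3_comm]; apply cancel g hg'; linear_combination h3 - hm
  have t3 : dot3 Nh u = g * -m := by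
    rw [dot3_comm]; apply cancel e he'; linear_combination h2 - hm
  have t4 : dot3 Nh v = g * -q := by
    rw [dot3_comm]; apply cancel g hg'; linear_combination h4 - hq
  have hNt2 : dot3 Nt Nt = e ^ 2 * (l ^ 2 + m ^ 2) := by
    rw [hfr.dot, t1, t2, h5]; ring
  have hNh2 : dot3 Nh Nh = g ^ 2 * (m ^ 2 + q ^ 2) := by
    rw [hfr.dot, t3, t4, h6]; ring
  have hNtNh : dot3 Nt Nh = e * g * (l * m + m * q) := by
    rw [hfr.dot, t1, t2, t3, t4, h5, h6]; ring
  have hx2' : x2 = -y1 := by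
    rw [dot3_comm u B, hx2, hy1] at h10
    apply cancel (e ^ 2 * g) (by positivity); linear_combination h10
  have hz1' : z1 = -y2 := by
    rw [dot3_comm u C, hy2, hz1] at h11
    apply cancel (e * g ^ 2) (by positivity); linear_combination h11
  subst hx2' hz1'
  have hj1' : j1 = n2 - l * y1 - m * y2 + m * x1 - q * y1 := by
    rw [dot3_comm u Nth, dot3_comm v Ntt, hfr.dot A Nh, hfr.dot B Nt, hx1, hx2, t3, t4, h6, hj1,
      hy1, hy2, t1, t2, h5, hn2] at h12
    apply cancel (e ^ 2 * g) (by positivity); linear_combination h12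
  have hj2' : j2 = k1 - m * y1 - q * y2 - l * y2 + m * z2 := by
    rw [dot3_comm u Nhh, dot3_comm v Nth, hfr.dot B Nh, hfr.dot C Nt, hy1, hy2, t3, t4, h6, hk1,
      hz1, hz2, t1, t2, h5, hj2] at h13
    apply cancel (e * g ^ 2) (by positivity); linear_combination -h13
  obtain ⟨c0, c1, hjet⟩ := jet_core l m q x1 y1 y2 z2 n1 n2 k1 k2 j1 j2 f f1 f2 f11 f12 f22
    hj1' hj2'
  have hfin := (hjet.const_mul (1 / 2)).hasDerivAt
  have uu := hfr.uu
  have vv := hfr.vv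
  have uv := hfr.uv
  have uw := hfr.uw
  have vw := hfr.vw
  have ww := hfr.ww
  have vu : dot3 v u = 0 := by rw [dot3_comm]; exact uv
  have wu : dot3 N u = 0 := by rw [dot3_comm]; exact uw
  have wv : dot3 N v = 0 := by rw [dot3_comm]; exact vw
  have s7 : dot3 Ntt N = -(e ^ 2 * (l ^ 2 + m ^ 2)) := by linear_combination h7 - hNt2
  have s8 : dot3 Nth N = -(e * g * (l * m + m * q)) := by linear_combination h8 - hNtNh
  have s9 : dot3 Nhh N = -(g ^ 2 * (m ^ 2 + q ^ 2)) := by linear_combination h9 - hNh2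
  have hfun : ∀ r : ℝ, _ := fun r => mc_scaled hfr he hg
      (e • u + r • ((e * f1) • N + f • Nt)) (g • v + r • ((g * f2) • N + f • Nh))
      (A + r • ((e ^ 2 * f11) • N + (2 * (e * f1)) • Nt + f • Ntt))
      (B + r • ((e * g * f12) • N + (e * f1) • Nh + (g * f2) • Nt + f • Nth))
      (C + r • ((g ^ 2 * f22) • N + (2 * (g * f2)) • Nh + f • Nhh))
      (a1 := 1 + r * (-(f * l))) (a2 := 0 + r * (-(f * m))) (a3 := 0 + r * f1)
      (b1 := 0 + r * (-(f * m))) (b2 := 1 + r * (-(f * q))) (b3 := 0 + r * f2)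
      (A1 := x1 + r * (-(2 * f1 * l) + f * n1)) (A2 := -y1 + r * (-(2 * f1 * m) + f * n2))
      (A3 := l + r * (f11 - f * (l ^ 2 + m ^ 2)))
      (B1 := y1 + r * (-(f1 * m) - f2 * l + f * j1))
      (B2 := y2 + r * (-(f1 * q) - f2 * m + f * j2))
      (B3 := m + r * (f12 - f * (l * m + m * q)))
      (C1 := -y2 + r * (-(2 * f2 * m) + f * k1)) (C2 := z2 + r * (-(2 * f2 * q) + f * k2))
      (C3 := q + r * (f22 - f * (m ^ 2 + q ^ 2)))
      (by simp only [dot3_add, dot3_smul, uu, wu, t1]; ring)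
      (by simp only [dot3_add, dot3_smul, uv, wv, t2]; ring)
      (by simp only [dot3_add, dot3_smul, uw, ww, h5]; ring)
      (by simp only [dot3_add, dot3_smul, vu, wu, t3]; ring)
      (by simp only [dot3_add, dot3_smul, vv, wv, t4]; ring)
      (by simp only [dot3_add, dot3_smul, vw, ww, h6]; ring)
      (by simp only [dot3_add, dot3_smul, hx1, wu, t1, hn1]; ring)
      (by simp only [dot3_add, dot3_smul, hx2, wv, t2, hn2]; ring)
      (by simp only [dot3_add, dot3_smul, hl, ww, h5, s7]; ring)
      (by simp only [dot3_add, dot3_smul, hy1, wu, t1, t3, hj1]; ring)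
      (by simp only [dot3_add, dot3_smul, hy2, wv, t2, t4, hj2]; ring)
      (by simp only [dot3_add, dot3_smul, hm, ww, h5, h6, s8]; ring)
      (by simp only [dot3_add, dot3_smul, hz1, wu, t3, hk1]; ring)
      (by simp only [dot3_add, dot3_smul, hz2, wv, t4, hk2]; ring)
      (by simp only [dot3_add, dot3_smul, hq, ww, h6, s9]; ring)
  have hfun' := funext hfun
  rw [hfun']
  refine hfin.congr_deriv ?_
  simp only [svVec, dot3_smul, dot3_smul_right, uu, vv, hl, hm, hq, hNt2, hNh2, hNtNh, hx1, hy1,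
    hy2, hz2, hn1, hn2, hk1, hk2]
  field_simp

/-! ### Partial derivatives on an open set -/

section Calculus

variable {E : Type*} [NormedAddCommGroup E] [NormedSpace ℝ E]

lemma slice_fst {F : ℝ → ℝ → E} {t θ : ℝ}
    (h : DifferentiableAt ℝ (fun p : ℝ × ℝ => F p.1 p.2) (t, θ)) :
    HasDerivAt (fun s => F s θ) (fderiv ℝ (fun p : ℝ × ℝ => F p.1 p.2) (t, θ) (1, 0)) t := by
  have h1 : HasDerivAt (fun s : ℝ => (s, θ)) ((1 : ℝ), (0 : ℝ)) t :=
    (hasDerivAt_id t).prodMk (hasDerivAt_const t θ)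
  exact h.hasFDerivAt.comp_hasDerivAt t h1

lemma slice_snd {F : ℝ → ℝ → E} {t θ : ℝ}
    (h : DifferentiableAt ℝ (fun p : ℝ × ℝ => F p.1 p.2) (t, θ)) :
    HasDerivAt (fun s => F t s) (fderiv ℝ (fun p : ℝ × ℝ => F p.1 p.2) (t, θ) (0, 1)) θ := by
  have h1 : HasDerivAt (fun s : ℝ => (t, s)) ((0 : ℝ), (1 : ℝ)) θ :=
    (hasDerivAt_const θ t).prodMk (hasDerivAt_id θ)
  exact h.hasFDerivAt.comp_hasDerivAt θ h1

variable {Ω : Set (ℝ × ℝ)} {n m : WithTop ℕ∞}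

lemma diffAt (hΩ : IsOpen Ω) {F : ℝ → ℝ → E}
    (hF : ContDiffOn ℝ n (fun p : ℝ × ℝ => F p.1 p.2) Ω) (hn : 1 ≤ n) {t θ : ℝ}
    (hp : (t, θ) ∈ Ω) : DifferentiableAt ℝ (fun p : ℝ × ℝ => F p.1 p.2) (t, θ) :=
  (hF.contDiffAt (hΩ.mem_nhds hp)).differentiableAt (by
    rintro rfl; simp at hn)

lemma hasDerivAt_pt (hΩ : IsOpen Ω) {F : ℝ → ℝ → E}
    (hF : ContDiffOn ℝ n (fun p : ℝ × ℝ => F p.1 p.2) Ω) (hn : 1 ≤ n) {t θ : ℝ}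
    (hp : (t, θ) ∈ Ω) : HasDerivAt (fun s => F s θ) (pt F t θ) t :=
  (slice_fst (diffAt hΩ hF hn hp)).differentiableAt.hasDerivAt

lemma hasDerivAt_pθ (hΩ : IsOpen Ω) {F : ℝ → ℝ → E}
    (hF : ContDiffOn ℝ n (fun p : ℝ × ℝ => F p.1 p.2) Ω) (hn : 1 ≤ n) {t θ : ℝ}
    (hp : (t, θ) ∈ Ω) : HasDerivAt (fun s => F t s) (pθ F t θ) θ :=
  (slice_snd (diffAt hΩ hF hn hp)).differentiableAt.hasDerivAt

lemma pt_eq (hΩ : IsOpen Ω) {F : ℝ → ℝ → E}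
    (hF : ContDiffOn ℝ n (fun p : ℝ × ℝ => F p.1 p.2) Ω) (hn : 1 ≤ n) {p : ℝ × ℝ}
    (hp : p ∈ Ω) : pt F p.1 p.2 = fderiv ℝ (fun p : ℝ × ℝ => F p.1 p.2) p (1, 0) :=
  (slice_fst (diffAt hΩ hF hn hp)).deriv

lemma pθ_eq (hΩ : IsOpen Ω) {F : ℝ → ℝ → E}
    (hF : ContDiffOn ℝ n (fun p : ℝ × ℝ => F p.1 p.2) Ω) (hn : 1 ≤ n) {p : ℝ × ℝ}
    (hp : p ∈ Ω) : pθ F p.1 p.2 = fderiv ℝ (fun p : ℝ × ℝ => F p.1 p.2) p (0, 1) :=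
  (slice_snd (diffAt hΩ hF hn hp)).deriv

lemma contDiffOn_pt (hΩ : IsOpen Ω) {F : ℝ → ℝ → E}
    (hF : ContDiffOn ℝ n (fun p : ℝ × ℝ => F p.1 p.2) Ω) (hmn : m + 1 ≤ n) :
    ContDiffOn ℝ m (fun p : ℝ × ℝ => pt F p.1 p.2) Ω := by
  have h1 := (hF.fderiv_of_isOpen hΩ hmn).clm_apply (contDiffOn_const (c := ((1 : ℝ), (0 : ℝ))))
  exact h1.congr fun p hp => pt_eq hΩ hF (le_trans (by simp) hmn) hp

lemma contDiffOn_pθ (hΩ : IsOpen Ω) {F : ℝ → ℝ → E}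
    (hF : ContDiffOn ℝ n (fun p : ℝ × ℝ => F p.1 p.2) Ω) (hmn : m + 1 ≤ n) :
    ContDiffOn ℝ m (fun p : ℝ × ℝ => pθ F p.1 p.2) Ω := by
  have h1 := (hF.fderiv_of_isOpen hΩ hmn).clm_apply (contDiffOn_const (c := ((0 : ℝ), (1 : ℝ))))
  exact h1.congr fun p hp => pθ_eq hΩ hF (le_trans (by simp) hmn) hp

lemma pt_congr (hΩ : IsOpen Ω) {F G : ℝ → ℝ → E} (h : ∀ t θ, (t, θ) ∈ Ω → F t θ = G t θ)
    {t θ : ℝ} (hp : (t, θ) ∈ Ω) : pt F t θ = pt G t θ := by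
  refine Filter.EventuallyEq.deriv_eq ?_
  have hc : ContinuousAt (fun s : ℝ => (s, θ)) t := by fun_prop
  filter_upwards [hc.preimage_mem_nhds (hΩ.mem_nhds hp)] with s hs using h s θ hs

lemma pθ_congr (hΩ : IsOpen Ω) {F G : ℝ → ℝ → E} (h : ∀ t θ, (t, θ) ∈ Ω → F t θ = G t θ)
    {t θ : ℝ} (hp : (t, θ) ∈ Ω) : pθ F t θ = pθ G t θ := by
  refine Filter.EventuallyEq.deriv_eq ?_
  have hc : ContinuousAt (fun s : ℝ => (t, s)) θ := by fun_prop
  filter_upwards [hc.preimage_mem_nhds (hΩ.mem_nhds hp)] with s hs using h t s hs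

lemma pt_pθ_comm (hΩ : IsOpen Ω) {F : ℝ → ℝ → E}
    (hF : ContDiffOn ℝ n (fun p : ℝ × ℝ => F p.1 p.2) Ω) (hn : 2 ≤ n) {t θ : ℝ}
    (hp : (t, θ) ∈ Ω) : pt (pθ F) t θ = pθ (pt F) t θ := by
  have h1n : (1 : WithTop ℕ∞) ≤ n := le_trans (by norm_num) hn
  have h2n : (1 : WithTop ℕ∞) + 1 ≤ n := le_trans (by norm_num) hn
  have hs := (hF.contDiffAt (hΩ.mem_nhds hp)).isSymmSndFDerivAt (by simpa using hn)
  have hd : DifferentiableAt ℝ (fderiv ℝ (fun p : ℝ × ℝ => F p.1 p.2)) (t, θ) :=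
    ((hF.fderiv_of_isOpen hΩ h2n).contDiffAt (hΩ.mem_nhds hp)).differentiableAt (by simp)
  have e1 : pt (pθ F) t θ =
      fderiv ℝ (fderiv ℝ (fun p : ℝ × ℝ => F p.1 p.2)) (t, θ) (1, 0) (0, 1) := by
    rw [pt_congr hΩ (G := fun t θ => fderiv ℝ (fun p : ℝ × ℝ => F p.1 p.2) (t, θ) (0, 1))
      (fun t θ h => pθ_eq hΩ hF h1n h) hp]
    have := (hd.hasFDerivAt.clm_apply (hasFDerivAt_const ((0 : ℝ), (1 : ℝ)) (t, θ)))
    have h3 := slice_fst (F := fun t θ => fderiv ℝ (fun p : ℝ × ℝ => F p.1 p.2) (t, θ) (0, 1))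
      this.differentiableAt
    refine h3.deriv.trans ?_
    erw [this.fderiv]
    simp
  have e2 : pθ (pt F) t θ =
      fderiv ℝ (fderiv ℝ (fun p : ℝ × ℝ => F p.1 p.2)) (t, θ) (0, 1) (1, 0) := by
    rw [pθ_congr hΩ (G := fun t θ => fderiv ℝ (fun p : ℝ × ℝ => F p.1 p.2) (t, θ) (1, 0))
      (fun t θ h => pt_eq hΩ hF h1n h) hp]
    have := (hd.hasFDerivAt.clm_apply (hasFDerivAt_const ((1 : ℝ), (0 : ℝ)) (t, θ)))
    have h3 := slice_snd (F := fun t θ => fderiv ℝ (fun p : ℝ × ℝ => F p.1 p.2) (t, θ) (1, 0))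
      this.differentiableAt
    refine h3.deriv.trans ?_
    erw [this.fderiv]
    simp
  rw [e1, e2]
  exact hs _ _

end Calculus

lemma hasDerivAt_dot3 {F G : ℝ → V3} {F' G' : V3} {x : ℝ} (hF : HasDerivAt F F' x)
    (hG : HasDerivAt G G' x) :
    HasDerivAt (fun s => dot3 (F s) (G s)) (dot3 F' (G x) + dot3 (F x) G') x := by
  have f := hasDerivAt_pi.mp hF
  have g := hasDerivAt_pi.mp hG
  refine ((((f 0).mul (g 0)).add ((f 1).mul (g 1))).add ((f 2).mul (g 2))).congr_deriv ?_
  simp only [dot3]; ring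

section Geometry

variable {Ω : Set (ℝ × ℝ)}

lemma pt_dot (hΩ : IsOpen Ω) {F G : ℝ → ℝ → V3} {n k : WithTop ℕ∞}
    (hF : ContDiffOn ℝ n (fun p : ℝ × ℝ => F p.1 p.2) Ω) (hn : 1 ≤ n)
    (hG : ContDiffOn ℝ k (fun p : ℝ × ℝ => G p.1 p.2) Ω) (hk : 1 ≤ k) {t θ : ℝ}
    (hp : (t, θ) ∈ Ω) : pt (fun u v => dot3 (F u v) (G u v)) t θ
      = dot3 (pt F t θ) (G t θ) + dot3 (F t θ) (pt G t θ) :=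
  (hasDerivAt_dot3 (hasDerivAt_pt hΩ hF hn hp) (hasDerivAt_pt hΩ hG hk hp)).deriv

lemma pθ_dot (hΩ : IsOpen Ω) {F G : ℝ → ℝ → V3} {n k : WithTop ℕ∞}
    (hF : ContDiffOn ℝ n (fun p : ℝ × ℝ => F p.1 p.2) Ω) (hn : 1 ≤ n)
    (hG : ContDiffOn ℝ k (fun p : ℝ × ℝ => G p.1 p.2) Ω) (hk : 1 ≤ k) {t θ : ℝ}
    (hp : (t, θ) ∈ Ω) : pθ (fun u v => dot3 (F u v) (G u v)) t θ
      = dot3 (pθ F t θ) (G t θ) + dot3 (F t θ) (pθ G t θ) :=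
  (hasDerivAt_dot3 (hasDerivAt_pθ hΩ hF hn hp) (hasDerivAt_pθ hΩ hG hk hp)).deriv

lemma contDiffOn_normal (hΩ : IsOpen Ω) {X : ℝ → ℝ → V3}
    (hX : ContDiffOn ℝ (⊤ : ℕ∞) (fun p : ℝ × ℝ => X p.1 p.2) Ω)
    (hreg : ∀ p : ℝ × ℝ, p ∈ Ω → cross3 (pt X p.1 p.2) (pθ X p.1 p.2) ≠ 0) :
    ContDiffOn ℝ (⊤ : ℕ∞) (fun p : ℝ × ℝ => normalVec X p.1 p.2) Ω := by
  have ha := contDiffOn_pi.mp (contDiffOn_pt (m := (⊤ : ℕ∞)) hΩ hX (by norm_cast))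
  have hb := contDiffOn_pi.mp (contDiffOn_pθ (m := (⊤ : ℕ∞)) hΩ hX (by norm_cast))
  have hc : ContDiffOn ℝ (⊤ : ℕ∞)
      (fun p : ℝ × ℝ => cross3 (pt X p.1 p.2) (pθ X p.1 p.2)) Ω := by
    refine contDiffOn_pi.mpr fun i => ?_
    fin_cases i
    · exact ((ha 1).mul (hb 2)).sub ((ha 2).mul (hb 1))
    · exact ((ha 2).mul (hb 0)).sub ((ha 0).mul (hb 2))
    · exact ((ha 0).mul (hb 1)).sub ((ha 1).mul (hb 0))
  have hc' := contDiffOn_pi.mp hc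
  have hd : ContDiffOn ℝ (⊤ : ℕ∞) (fun p : ℝ × ℝ => dot3 (cross3 (pt X p.1 p.2) (pθ X p.1 p.2))
      (cross3 (pt X p.1 p.2) (pθ X p.1 p.2))) Ω :=
    (((hc' 0).mul (hc' 0)).add ((hc' 1).mul (hc' 1))).add ((hc' 2).mul (hc' 2))
  have hs := hd.sqrt fun p hp => (dot3_self_pos (hreg p hp)).ne'
  have hi := hs.inv fun p hp => (Real.sqrt_pos.mpr (dot3_self_pos (hreg p hp))).ne'
  exact hi.smul hc

lemma normal_props {X : ℝ → ℝ → V3} {t θ : ℝ} (hreg : cross3 (pt X t θ) (pθ X t θ) ≠ 0) :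
    dot3 (pt X t θ) (normalVec X t θ) = 0 ∧ dot3 (pθ X t θ) (normalVec X t θ) = 0 ∧
      dot3 (normalVec X t θ) (normalVec X t θ) = 1 := by
  have hpos := dot3_self_pos hreg
  simp only [normalVec, dot3_smul_right, dot3_smul]
  refine ⟨?_, ?_, ?_⟩
  · have : dot3 (pt X t θ) (cross3 (pt X t θ) (pθ X t θ)) = 0 := by simp [dot3, cross3]; ring
    rw [this, mul_zero]
  · have : dot3 (pθ X t θ) (cross3 (pt X t θ) (pθ X t θ)) = 0 := by simp [dot3, cross3]; ring
    rw [this, mul_zero]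
  · have h0 : norm3 (cross3 (pt X t θ) (pθ X t θ)) ≠ 0 := (Real.sqrt_pos.mpr hpos).ne'
    have h1 : norm3 (cross3 (pt X t θ) (pθ X t θ)) ^ 2 = _ := Real.sq_sqrt hpos.le
    rw [← h1]; field_simp

/-- Derivatives of `φ • N`-type expressions. -/
lemma pt_pert (hΩ : IsOpen Ω) {X N : ℝ → ℝ → V3} {φ : ℝ → ℝ → ℝ}
    (hX : ContDiffOn ℝ 1 (fun p : ℝ × ℝ => X p.1 p.2) Ω)
    (hN : ContDiffOn ℝ 1 (fun p : ℝ × ℝ => N p.1 p.2) Ω)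
    (hφ : ContDiffOn ℝ 1 (fun p : ℝ × ℝ => φ p.1 p.2) Ω) (r : ℝ) {t θ : ℝ}
    (hp : (t, θ) ∈ Ω) :
    HasDerivAt (fun s => X s θ + (r * φ s θ) • N s θ)
      (pt X t θ + r • (pt φ t θ • N t θ + φ t θ • pt N t θ)) t := by
  refine ((hasDerivAt_pt hΩ hX le_rfl hp).add (((hasDerivAt_pt hΩ hφ le_rfl hp).const_mul r).smul
    (hasDerivAt_pt hΩ hN le_rfl hp))).congr_deriv ?_
  module

lemma pθ_pert (hΩ : IsOpen Ω) {X N : ℝ → ℝ → V3} {φ : ℝ → ℝ → ℝ}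
    (hX : ContDiffOn ℝ 1 (fun p : ℝ × ℝ => X p.1 p.2) Ω)
    (hN : ContDiffOn ℝ 1 (fun p : ℝ × ℝ => N p.1 p.2) Ω)
    (hφ : ContDiffOn ℝ 1 (fun p : ℝ × ℝ => φ p.1 p.2) Ω) (r : ℝ) {t θ : ℝ}
    (hp : (t, θ) ∈ Ω) :
    HasDerivAt (fun s => X t s + (r * φ t s) • N t s)
      (pθ X t θ + r • (pθ φ t θ • N t θ + φ t θ • pθ N t θ)) θ := by
  refine ((hasDerivAt_pθ hΩ hX le_rfl hp).add (((hasDerivAt_pθ hΩ hφ le_rfl hp).const_mul r).smul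
    (hasDerivAt_pθ hΩ hN le_rfl hp))).congr_deriv ?_
  module

end Geometry

/-- Second variation of the mean curvature under normal perturbations of an
orthogonal parametrization. -/
theorem second_variation_mean_curvature
    (Ω : Set (ℝ × ℝ)) (hΩo : IsOpen Ω) (hΩc : IsConnected Ω)
    (X : ℝ → ℝ → V3)
    (hX : ContDiffOn ℝ (⊤ : ℕ∞) (fun p : ℝ × ℝ => X p.1 p.2) Ω)
    (horth : ∀ p : ℝ × ℝ, p ∈ Ω → dot3 (pt X p.1 p.2) (pθ X p.1 p.2) = 0)
    (hreg : ∀ p : ℝ × ℝ, p ∈ Ω → cross3 (pt X p.1 p.2) (pθ X p.1 p.2) ≠ 0)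
    (φ : ℝ → ℝ → ℝ)
    (hφ : ContDiffOn ℝ 2 (fun p : ℝ × ℝ => φ p.1 p.2) Ω) :
    ∀ t θ : ℝ, (t, θ) ∈ Ω →
      HasDerivAt (fun s : ℝ => deriv (fun r : ℝ => meanCurv (pert X φ r) t θ) s)
        (secondVariation X φ t θ) 0 := by
  intro t θ hp
  have topLe : ∀ k : ℕ, ((k : ℕ) : WithTop ℕ∞) ≤ ((⊤ : ℕ∞) : WithTop ℕ∞) := fun k => by
    exact_mod_cast le_top
  have one_le : (1 : WithTop ℕ∞) ≤ ((⊤ : ℕ∞) : WithTop ℕ∞) := by exact_mod_cast topLe 1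
  have two_le : (2 : WithTop ℕ∞) ≤ ((⊤ : ℕ∞) : WithTop ℕ∞) := by exact_mod_cast topLe 2
  have top_le : ((⊤ : ℕ∞) : WithTop ℕ∞) + 1 ≤ ((⊤ : ℕ∞) : WithTop ℕ∞) := by norm_cast
  have hN := contDiffOn_normal hΩo hX hreg
  have hprops : ∀ t θ, (t, θ) ∈ Ω → _ := fun t θ h => normal_props (hreg (t, θ) h)
  obtain ⟨N, hNdef⟩ : ∃ N, N = normalVec X := ⟨_, rfl⟩
  rw [← hNdef] at hN
  simp only [← hNdef] at hprops
  have hXt := contDiffOn_pt (m := (⊤ : ℕ∞)) hΩo hX top_le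
  have hXh := contDiffOn_pθ (m := (⊤ : ℕ∞)) hΩo hX top_le
  have hNt := contDiffOn_pt (m := (⊤ : ℕ∞)) hΩo hN top_le
  have hNh := contDiffOn_pθ (m := (⊤ : ℕ∞)) hΩo hN top_le
  have hφt := contDiffOn_pt (m := 1) hΩo hφ (by norm_num)
  have hφh := contDiffOn_pθ (m := 1) hΩo hφ (by norm_num)
  have hφ1 : ContDiffOn ℝ 1 (fun p : ℝ × ℝ => φ p.1 p.2) Ω := hφ.of_le (by norm_num)
  have pconst : ∀ c : ℝ, pt (fun _ _ : ℝ => c) t θ = 0 := fun c => deriv_const _ _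
  -- first order relations on `Ω`
  have ct : ∀ {F : ℝ → ℝ → ℝ} (c : ℝ), (∀ t θ, (t, θ) ∈ Ω → F t θ = c) →
      ∀ t θ, (t, θ) ∈ Ω → pt F t θ = 0 := fun {F} c h t θ hp =>
    (pt_congr hΩo (G := fun _ _ => c) h hp).trans (deriv_const _ _)
  have ch : ∀ {F : ℝ → ℝ → ℝ} (c : ℝ), (∀ t θ, (t, θ) ∈ Ω → F t θ = c) →
      ∀ t θ, (t, θ) ∈ Ω → pθ F t θ = 0 := fun {F} c h t θ hp =>
    (pθ_congr hΩo (G := fun _ _ => c) h hp).trans (deriv_const _ _)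
  have R1 : ∀ t θ, (t, θ) ∈ Ω →
      dot3 (pt (pt X) t θ) (N t θ) + dot3 (pt X t θ) (pt N t θ) = 0 := fun t θ h => by
    rw [← pt_dot hΩo hXt one_le hN one_le h]
    exact ct 0 (fun t θ h => (hprops t θ h).1) t θ h
  have R2 : ∀ t θ, (t, θ) ∈ Ω →
      dot3 (pθ (pt X) t θ) (N t θ) + dot3 (pt X t θ) (pθ N t θ) = 0 := fun t θ h => by
    rw [← pθ_dot hΩo hXt one_le hN one_le h]
    exact ch 0 (fun t θ h => (hprops t θ h).1) t θ h
  have R3 : ∀ t θ, (t, θ) ∈ Ω →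
      dot3 (pθ (pt X) t θ) (N t θ) + dot3 (pθ X t θ) (pt N t θ) = 0 := fun t θ h => by
    rw [← pt_pθ_comm hΩo hX two_le h, ← pt_dot hΩo hXh one_le hN one_le h]
    exact ct 0 (fun t θ h => (hprops t θ h).2.1) t θ h
  have R4 : ∀ t θ, (t, θ) ∈ Ω →
      dot3 (pθ (pθ X) t θ) (N t θ) + dot3 (pθ X t θ) (pθ N t θ) = 0 := fun t θ h => by
    rw [← pθ_dot hΩo hXh one_le hN one_le h]
    exact ch 0 (fun t θ h => (hprops t θ h).2.1) t θ h
  have R5 : ∀ t θ, (t, θ) ∈ Ω → dot3 (pt N t θ) (N t θ) = 0 := fun t θ h => by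
    have h1 := pt_dot hΩo hN one_le hN one_le h
    rw [ct 1 (fun t θ h => (hprops t θ h).2.2) t θ h, dot3_comm (N t θ)] at h1
    linarith
  have R6 : ∀ t θ, (t, θ) ∈ Ω → dot3 (pθ N t θ) (N t θ) = 0 := fun t θ h => by
    have h1 := pθ_dot hΩo hN one_le hN one_le h
    rw [ch 1 (fun t θ h => (hprops t θ h).2.2) t θ h, dot3_comm (N t θ)] at h1
    linarith
  have R7 : dot3 (pt (pt N) t θ) (N t θ) + dot3 (pt N t θ) (pt N t θ) = 0 := by
    rw [← pt_dot hΩo hNt one_le hN one_le hp]; exact ct 0 R5 t θ hp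
  have R8 : dot3 (pθ (pt N) t θ) (N t θ) + dot3 (pt N t θ) (pθ N t θ) = 0 := by
    rw [← pθ_dot hΩo hNt one_le hN one_le hp]; exact ch 0 R5 t θ hp
  have R9 : dot3 (pθ (pθ N) t θ) (N t θ) + dot3 (pθ N t θ) (pθ N t θ) = 0 := by
    rw [← pθ_dot hΩo hNh one_le hN one_le hp]; exact ch 0 R6 t θ hp
  have R10 : dot3 (pt (pt X) t θ) (pθ X t θ) + dot3 (pt X t θ) (pθ (pt X) t θ) = 0 := by
    rw [← pt_pθ_comm hΩo hX two_le hp, ← pt_dot hΩo hXt one_le hXh one_le hp]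
    exact ct 0 (fun t θ h => horth (t, θ) h) t θ hp
  have R11 : dot3 (pθ (pt X) t θ) (pθ X t θ) + dot3 (pt X t θ) (pθ (pθ X) t θ) = 0 := by
    rw [← pθ_dot hΩo hXt one_le hXh one_le hp]
    exact ch 0 (fun t θ h => horth (t, θ) h) t θ hp
  have RC : ∀ t θ, (t, θ) ∈ Ω →
      dot3 (pt X t θ) (pθ N t θ) = dot3 (pθ X t θ) (pt N t θ) := fun t θ h => by
    linarith [R2 t θ h, R3 t θ h]
  have R12 : dot3 (pt (pt X) t θ) (pθ N t θ) + dot3 (pt X t θ) (pθ (pt N) t θ)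
      = dot3 (pθ (pt X) t θ) (pt N t θ) + dot3 (pθ X t θ) (pt (pt N) t θ) := by
    rw [← pt_pθ_comm hΩo hX two_le hp, ← pt_pθ_comm hΩo hN two_le hp,
      ← pt_dot hΩo hXt one_le hNh one_le hp, ← pt_dot hΩo hXh one_le hNt one_le hp]
    exact pt_congr hΩo RC hp
  have R13 : dot3 (pθ (pt X) t θ) (pθ N t θ) + dot3 (pt X t θ) (pθ (pθ N) t θ)
      = dot3 (pθ (pθ X) t θ) (pt N t θ) + dot3 (pθ X t θ) (pθ (pt N) t θ) := by
    rw [← pθ_dot hΩo hXt one_le hNh one_le hp, ← pθ_dot hΩo hXh one_le hNt one_le hp]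
    exact pθ_congr hΩo RC hp
  have hcore := core_vec (pt X t θ) (pθ X t θ) (N t θ) (pt (pt X) t θ) (pθ (pt X) t θ)
    (pθ (pθ X) t θ) (pt N t θ) (pθ N t θ) (pt (pt N) t θ) (pθ (pt N) t θ) (pθ (pθ N) t θ)
    (φ t θ) (pt φ t θ) (pθ φ t θ) (pt (pt φ) t θ) (pθ (pt φ) t θ) (pθ (pθ φ) t θ)
    (horth (t, θ) hp) (hreg (t, θ) hp) (by rw [hNdef]; rfl) (R1 t θ hp) (R2 t θ hp) (R3 t θ hp)
    (R4 t θ hp) (R5 t θ hp) (R6 t θ hp) R7 R8 R9 R10 R11 R12 R13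
  -- the metric derivatives
  have D1 : pt (fun u v => dot3 (pt X u v) (pt X u v)) t θ
      = 2 * dot3 (pt (pt X) t θ) (pt X t θ) := by
    rw [pt_dot hΩo hXt one_le hXt one_le hp, dot3_comm (pt X t θ)]; ring
  have D2 : pθ (fun u v => dot3 (pt X u v) (pt X u v)) t θ
      = 2 * dot3 (pθ (pt X) t θ) (pt X t θ) := by
    rw [pθ_dot hΩo hXt one_le hXt one_le hp, dot3_comm (pt X t θ)]; ring
  have D3 : pt (fun u v => dot3 (pθ X u v) (pθ X u v)) t θ
      = 2 * dot3 (pθ (pt X) t θ) (pθ X t θ) := by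
    rw [pt_dot hΩo hXh one_le hXh one_le hp, dot3_comm (pθ X t θ), pt_pθ_comm hΩo hX two_le hp]
    ring
  have D4 : pθ (fun u v => dot3 (pθ X u v) (pθ X u v)) t θ
      = 2 * dot3 (pθ (pθ X) t θ) (pθ X t θ) := by
    rw [pθ_dot hΩo hXh one_le hXh one_le hp, dot3_comm (pθ X t θ)]; ring
  have hval : svVec (pt X t θ) (pθ X t θ) (N t θ) (pt (pt X) t θ) (pθ (pt X) t θ)
      (pθ (pθ X) t θ) (pt N t θ) (pθ N t θ) (pt (pt N) t θ) (pθ (pθ N) t θ)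
      (2 * dot3 (pt (pt X) t θ) (pt X t θ)) (2 * dot3 (pθ (pt X) t θ) (pt X t θ))
      (2 * dot3 (pθ (pt X) t θ) (pθ X t θ)) (2 * dot3 (pθ (pθ X) t θ) (pθ X t θ))
      (φ t θ) (pt φ t θ) (pθ φ t θ) (pt (pt φ) t θ) (pθ (pt φ) t θ) (pθ (pθ φ) t θ)
      = secondVariation X φ t θ := by
    rw [← D1, ← D2, ← D3, ← D4, hNdef]; rfl
  rw [hval] at hcore
  -- derivatives of the perturbed parametrization
  have hX1 := hX.of_le one_le
  have hN1 := hN.of_le one_le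
  have Yt : ∀ r t θ, (t, θ) ∈ Ω → pt (pert X φ r) t θ
      = pt X t θ + r • (pt φ t θ • N t θ + φ t θ • pt N t θ) := fun r t θ h => by
    rw [hNdef]; rw [hNdef] at hN1
    exact (pt_pert hΩo hX1 hN1 hφ1 r h).deriv
  have Yh : ∀ r t θ, (t, θ) ∈ Ω → pθ (pert X φ r) t θ
      = pθ X t θ + r • (pθ φ t θ • N t θ + φ t θ • pθ N t θ) := fun r t θ h => by
    rw [hNdef]; rw [hNdef] at hN1
    exact (pθ_pert hΩo hX1 hN1 hφ1 r h).deriv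
  have Ytt : ∀ r, pt (pt (pert X φ r)) t θ = pt (pt X) t θ
      + r • (pt (pt φ) t θ • N t θ + (2 * pt φ t θ) • pt N t θ + φ t θ • pt (pt N) t θ) := by
    intro r
    rw [pt_congr hΩo (Yt r) hp]
    refine HasDerivAt.deriv (HasDerivAt.congr_deriv ((hasDerivAt_pt hΩo hXt one_le hp).add
      ((((hasDerivAt_pt hΩo hφt le_rfl hp).smul (hasDerivAt_pt hΩo hN one_le hp)).add
        ((hasDerivAt_pt hΩo hφ1 le_rfl hp).smul (hasDerivAt_pt hΩo hNt one_le hp))).const_smul r))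
        ?_)
    module
  have Yth : ∀ r, pθ (pt (pert X φ r)) t θ = pθ (pt X) t θ
      + r • (pθ (pt φ) t θ • N t θ + pt φ t θ • pθ N t θ + pθ φ t θ • pt N t θ
        + φ t θ • pθ (pt N) t θ) := by
    intro r
    rw [pθ_congr hΩo (Yt r) hp]
    refine HasDerivAt.deriv (HasDerivAt.congr_deriv ((hasDerivAt_pθ hΩo hXt one_le hp).add
      ((((hasDerivAt_pθ hΩo hφt le_rfl hp).smul (hasDerivAt_pθ hΩo hN one_le hp)).add
        ((hasDerivAt_pθ hΩo hφ1 le_rfl hp).smul (hasDerivAt_pθ hΩo hNt one_le hp))).const_smul r))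
        ?_)
    module
  have Yhh : ∀ r, pθ (pθ (pert X φ r)) t θ = pθ (pθ X) t θ
      + r • (pθ (pθ φ) t θ • N t θ + (2 * pθ φ t θ) • pθ N t θ + φ t θ • pθ (pθ N) t θ) := by
    intro r
    rw [pθ_congr hΩo (Yh r) hp]
    refine HasDerivAt.deriv (HasDerivAt.congr_deriv ((hasDerivAt_pθ hΩo hXh one_le hp).add
      ((((hasDerivAt_pθ hΩo hφh le_rfl hp).smul (hasDerivAt_pθ hΩo hN one_le hp)).add
        ((hasDerivAt_pθ hΩo hφ1 le_rfl hp).smul (hasDerivAt_pθ hΩo hNh one_le hp))).const_smul r))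
        ?_)
    module
  have hfun : (fun r : ℝ => meanCurv (pert X φ r) t θ) = fun r : ℝ =>
      mc (pt X t θ + r • (pt φ t θ • N t θ + φ t θ • pt N t θ))
        (pθ X t θ + r • (pθ φ t θ • N t θ + φ t θ • pθ N t θ))
        (pt (pt X) t θ
          + r • (pt (pt φ) t θ • N t θ + (2 * pt φ t θ) • pt N t θ + φ t θ • pt (pt N) t θ))
        (pθ (pt X) t θ + r • (pθ (pt φ) t θ • N t θ + pt φ t θ • pθ N t θ + pθ φ t θ • pt N t θ
          + φ t θ • pθ (pt N) t θ))
        (pθ (pθ X) t θ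
          + r • (pθ (pθ φ) t θ • N t θ + (2 * pθ φ t θ) • pθ N t θ + φ t θ • pθ (pθ N) t θ)) := by
    funext r
    rw [← Yt r t θ hp, ← Yh r t θ hp, ← Ytt r, ← Yth r, ← Yhh r]
    rfl
  rw [hfun]
  exact hcore

end Delaunay
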